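/- Let n ≥ 2, let Σ be a finite set of n×n row-stochastic real matrices, and suppose there exists p ≥ 1 such that every product M = A_p ⋯ A_1 of p matrices from Σ contracts ‖·‖_P, i.e., ‖Mx‖_P < 1 whenever ‖x‖_P ≤ 1. Then for every sequence σ : ℕ → Σ, the partial products P_t = A_{σ(t)} ⋯ A_{σ(1)} converge entrywise, as t → ∞, to a matrix of rank one. -/

import Mathlib

open Filter Matrix

/-- A matrix is (row-)stochastic if its entries are nonnegative and each row sums to 1. -/
def IsStochastic {n : ℕ} (A : Matrix (Fin n) (Fin n) ℝ) : Prop :=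
  (∀ i j, 0 ≤ A i j) ∧ ∀ i, ∑ j, A i j = 1

/-- The seminorm `‖x‖_P = (1/2)(max_i x_i − min_i x_i)`. -/
noncomputable def normP {n : ℕ} (x : Fin n → ℝ) : ℝ :=
  (1 / 2) * ((⨆ i, x i) - ⨅ i, x i)

/-- Partial products `P t = σ(t) ⋯ σ(1)` of a sequence of matrices (P 0 = identity). -/
def partialProd {n : ℕ} (σ : ℕ → Matrix (Fin n) (Fin n) ℝ) : ℕ → Matrix (Fin n) (Fin n) ℝ
  | 0 => 1
  | t + 1 => σ (t + 1) * partialProd σ t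

/-- A sequence of matrices converges (entrywise) to a rank-one matrix. -/
def ConvergesToRankOne {n : ℕ} (P : ℕ → Matrix (Fin n) (Fin n) ℝ) : Prop :=
  ∃ L : Matrix (Fin n) (Fin n) ℝ, L.rank = 1 ∧
    ∀ i j, Tendsto (fun t => P t i j) atTop (nhds (L i j))

theorem IsStochastic.one {n : ℕ} : IsStochastic (1 : Matrix (Fin n) (Fin n) ℝ) := by
  refine ⟨fun i j => ?_, fun i => by simp [Matrix.one_apply]⟩
  rw [Matrix.one_apply]
  split_ifs <;> norm_num

theorem IsStochastic.mul {n : ℕ} {A B : Matrix (Fin n) (Fin n) ℝ}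
    (hA : IsStochastic A) (hB : IsStochastic B) : IsStochastic (A * B) := by
  refine ⟨fun i j => ?_, fun i => ?_⟩
  · rw [Matrix.mul_apply]
    exact Finset.sum_nonneg fun k _ => mul_nonneg (hA.1 i k) (hB.1 k j)
  · simp only [Matrix.mul_apply]
    rw [Finset.sum_comm]
    simp only [← Finset.mul_sum, hB.2, mul_one, hA.2]

theorem partialProd_add {n : ℕ} (σ : ℕ → Matrix (Fin n) (Fin n) ℝ) (t s : ℕ) :
    partialProd σ (t + s) =
      (List.ofFn fun i : Fin s => σ (t + s - i)).prod * partialProd σ t := by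
  induction s with
  | zero => simp
  | succ s ih =>
    rw [← add_assoc, partialProd, ih, List.ofFn_succ, List.prod_cons, Matrix.mul_assoc]
    simp [Nat.add_sub_add_right]

theorem isStochastic_listProd {n : ℕ} (l : List (Matrix (Fin n) (Fin n) ℝ))
    (hl : ∀ A ∈ l, IsStochastic A) : IsStochastic l.prod := by
  induction l with
  | nil => exact IsStochastic.one
  | cons A l ih =>
    rw [List.prod_cons]
    exact (hl A (by simp)).mul (ih fun B hB => hl B (by simp [hB]))

theorem sum_posPart_lt_one_of_normP_contracts {n : ℕ} {M : Matrix (Fin n) (Fin n) ℝ}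
    (h : ∀ x : Fin n → ℝ, normP x ≤ 1 → normP (M.mulVec x) < 1) (i k : Fin n) :
    ∑ j, max (M i j - M k j) 0 < 1 := by
  have : Nonempty (Fin n) := ⟨i⟩
  set x : Fin n → ℝ := fun j => if M k j < M i j then 2 else 0 with hx
  have hx1 : normP x ≤ 1 := by
    have h1 : (⨆ j, x j) ≤ 2 := ciSup_le fun j => by simp only [hx]; split_ifs <;> norm_num
    have h2 : 0 ≤ ⨅ j, x j := le_ciInf fun j => by simp only [hx]; split_ifs <;> norm_num
    unfold normP
    linarith
  have h3 := h x hx1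
  unfold normP at h3
  have h4 : M.mulVec x i ≤ ⨆ j, M.mulVec x j := le_ciSup (Set.finite_range _).bddAbove i
  have h5 : ⨅ j, M.mulVec x j ≤ M.mulVec x k := ciInf_le (Set.finite_range _).bddBelow k
  have h6 : M.mulVec x i - M.mulVec x k = 2 * ∑ j, max (M i j - M k j) 0 := by
    simp only [Matrix.mulVec, dotProduct]
    rw [← Finset.sum_sub_distrib, Finset.mul_sum]
    refine Finset.sum_congr rfl fun j _ => ?_
    simp only [hx]
    split_ifs with hj
    · rw [max_eq_left (by linarith)]; ring
    · rw [max_eq_right (by linarith)]; ring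
  linarith

theorem mul_apply_sub_le {n : ℕ} {M Q : Matrix (Fin n) (Fin n) ℝ} (hM : IsStochastic M)
    {c s : ℝ} (hc : ∀ i k, ∑ j, max (M i j - M k j) 0 ≤ c)
    {l : Fin n} (hs : ∀ i k, Q i l - Q k l ≤ s) (i k : Fin n) :
    (M * Q) i l - (M * Q) k l ≤ c * s := by
  have : Nonempty (Fin n) := ⟨i⟩
  obtain ⟨m, hm⟩ := Finite.exists_min fun j => Q j l
  have hs0 : 0 ≤ s := by simpa using hs i i
  have h1 : (M * Q) i l - (M * Q) k l = ∑ j, (M i j - M k j) * (Q j l - Q m l) := by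
    simp only [sub_mul, mul_sub, Finset.sum_sub_distrib, ← Finset.sum_mul, hM.2,
      Matrix.mul_apply]
    ring
  rw [h1]
  calc ∑ j, (M i j - M k j) * (Q j l - Q m l)
      ≤ ∑ j, max (M i j - M k j) 0 * s := Finset.sum_le_sum fun j _ =>
        mul_le_mul (le_max_left _ _) (hs j m) (sub_nonneg.2 (hm j)) (le_max_right _ _)
    _ ≤ c * s := by
        rw [← Finset.sum_mul]
        exact mul_le_mul_of_nonneg_right (hc i k) hs0

theorem abs_mul_apply_sub_le {n : ℕ} {M Q : Matrix (Fin n) (Fin n) ℝ} (hM : IsStochastic M)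
    {s : ℝ} {l : Fin n} (hs : ∀ i k, Q i l - Q k l ≤ s) (i : Fin n) :
    |(M * Q) i l - Q i l| ≤ s := by
  have h1 : (M * Q) i l - Q i l = ∑ j, M i j * (Q j l - Q i l) := by
    simp only [mul_sub, Finset.sum_sub_distrib, ← Finset.sum_mul, hM.2, Matrix.mul_apply]
    ring
  rw [h1]
  calc |∑ j, M i j * (Q j l - Q i l)| ≤ ∑ j, |M i j * (Q j l - Q i l)| :=
        Finset.abs_sum_le_sum_abs _ _
    _ ≤ ∑ j, M i j * s := Finset.sum_le_sum fun j _ => by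
        rw [abs_mul, abs_of_nonneg (hM.1 i j)]
        exact mul_le_mul_of_nonneg_left
          (abs_le.2 ⟨by linarith [hs i j], hs j i⟩) (hM.1 i j)
    _ = s := by rw [← Finset.sum_mul, hM.2, one_mul]

theorem rank_eq_one_of_rows_eq {n : ℕ} {L : Matrix (Fin n) (Fin n) ℝ} (i₀ : Fin n)
    (hrow : ∀ i j, L i j = L i₀ j) (hsum : ∑ j, L i₀ j = 1) : L.rank = 1 := by
  have hL : L = Matrix.vecMulVec (fun _ => 1) (L i₀) := by
    ext i j
    simp [Matrix.vecMulVec_apply, hrow i j]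
  have hle : L.rank ≤ 1 := by
    rw [hL]
    exact Matrix.rank_vecMulVec_le _ _
  have hne : L.rank ≠ 0 := by
    intro h
    rw [Matrix.rank, Submodule.finrank_eq_zero, LinearMap.range_eq_bot] at h
    have h1 := congrFun (LinearMap.congr_fun h fun _ => 1) i₀
    simp [Matrix.mulVec, dotProduct, hsum] at h1
  omega

theorem stmt16 (n : ℕ) (hn : 2 ≤ n) (Sig : Finset (Matrix (Fin n) (Fin n) ℝ))
    (hstoch : ∀ A ∈ Sig, IsStochastic A)
    (p : ℕ) (hp : 1 ≤ p)
    (hcontr : ∀ B : Fin p → Matrix (Fin n) (Fin n) ℝ, (∀ i, B i ∈ Sig) →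
      ∀ x : Fin n → ℝ, normP x ≤ 1 → normP ((List.ofFn B).prod.mulVec x) < 1) :
    ∀ σ : ℕ → Matrix (Fin n) (Fin n) ℝ, (∀ t, σ t ∈ Sig) →
      ConvergesToRankOne (partialProd σ) := by
  intro σ hσ
  have hn0 : 0 < n := by omega
  let i₀ : Fin n := ⟨0, hn0⟩
  have : Nonempty (Fin n) := ⟨i₀⟩
  have : Nonempty Sig := ⟨⟨σ 0, hσ 0⟩⟩
  have hP : ∀ t, IsStochastic (partialProd σ t) := by
    intro t
    induction t with
    | zero => exact IsStochastic.one
    | succ t ih => exact (hstoch _ (hσ _)).mul ih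
  have htail : ∀ t s, IsStochastic (List.ofFn fun i : Fin s => σ (t + s - i)).prod := by
    intro t s
    refine isStochastic_listProd _ fun A hA => ?_
    obtain ⟨i, rfl⟩ := List.mem_ofFn.1 hA
    exact hstoch _ (hσ _)
  obtain ⟨c, hc0, hc1, hc⟩ : ∃ c : ℝ, 0 ≤ c ∧ c < 1 ∧
      ∀ B : Fin p → Matrix (Fin n) (Fin n) ℝ, (∀ i, B i ∈ Sig) → ∀ i k,
        ∑ j, max ((List.ofFn B).prod i j - (List.ofFn B).prod k j) 0 ≤ c := by
    let f : (Fin p → Sig) × Fin n × Fin n → ℝ := fun z =>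
      ∑ j, max ((List.ofFn fun i => (z.1 i).1).prod z.2.1 j -
        (List.ofFn fun i => (z.1 i).1).prod z.2.2 j) 0
    obtain ⟨z, hz⟩ := Finite.exists_max f
    refine ⟨f z, Finset.sum_nonneg fun j _ => le_max_right _ _,
      sum_posPart_lt_one_of_normP_contracts (hcontr _ fun i => (z.1 i).2) _ _,
      fun B hB i k => hz (fun a => ⟨B a, hB a⟩, i, k)⟩
  have hspread : ∀ q l i k,
      partialProd σ (q * p) i l - partialProd σ (q * p) k l ≤ c ^ q := by
    intro q l
    induction q with
    | zero =>
      intro i k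
      simp only [Nat.zero_mul, partialProd, pow_zero, Matrix.one_apply]
      split_ifs <;> norm_num
    | succ q ih =>
      intro i k
      rw [Nat.succ_mul, partialProd_add, pow_succ']
      exact mul_apply_sub_le (htail _ _) (hc _ fun _ => hσ _) ih i k
  have hdist : ∀ q t, q * p ≤ t → ∀ i l,
      |partialProd σ t i l - partialProd σ (q * p) i l| ≤ c ^ q := by
    intro q t hqt i l
    obtain ⟨s, rfl⟩ := Nat.exists_eq_add_of_le hqt
    rw [partialProd_add]
    exact abs_mul_apply_sub_le (htail _ _) (hspread q l) i
  have hlim : ∀ i l, ∃ a, Tendsto (fun t => partialProd σ t i l) atTop (nhds a) := by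
    intro i l
    refine cauchySeq_tendsto_of_complete (Metric.cauchySeq_iff'.2 fun ε hε => ?_)
    obtain ⟨q, hq⟩ := exists_pow_lt_of_lt_one hε hc1
    exact ⟨q * p, fun t ht => (hdist q t ht i l).trans_lt hq⟩
  choose L hL using hlim
  have hsub : Tendsto (fun q : ℕ => q * p) atTop atTop :=
    tendsto_id.atTop_mul_const' (by omega)
  have hle : ∀ i k l, L i l - L k l ≤ 0 := fun i k l =>
    le_of_tendsto_of_tendsto' (((hL i l).comp hsub).sub ((hL k l).comp hsub))
      (tendsto_pow_atTop_nhds_zero_of_lt_one hc0 hc1) fun q => hspread q l i k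
  refine ⟨Matrix.of L, rank_eq_one_of_rows_eq i₀
    (fun i j => le_antisymm (sub_nonpos.1 (hle i i₀ j)) (sub_nonpos.1 (hle i₀ i j))) ?_, hL⟩
  refine tendsto_nhds_unique (tendsto_finsetSum Finset.univ fun j _ => hL i₀ j) ?_
  simp only [(hP _).2]
  exact tendsto_const_nhds
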